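/- Assume entanglement of formation is superadditive. Then the Holevo capacity is additive: C(T ⊗ T') = C(T) + C(T') for all channels T, T'. -/

import Mathlib

open scoped Matrix Kronecker ComplexOrder
open Matrix

noncomputable section

/-- Square complex matrices indexed by `d`. -/
abbrev Mat (d : Type) [Fintype d] : Type := Matrix d d ℂ

/-- A density operator: positive semidefinite with unit trace. -/
def IsState {d : Type} [Fintype d] [DecidableEq d] (ρ : Mat d) : Prop :=
  ρ.PosSemidef ∧ ρ.trace = 1

/-- Von Neumann entropy `S(ρ) = -Tr ρ log ρ`, via eigenvalues (junk value 0
if `ρ` is not Hermitian). -/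
def entropy {d : Type} [Fintype d] [DecidableEq d] (ρ : Mat d) : ℝ :=
  if h : ρ.IsHermitian then ∑ i, Real.negMulLog (h.eigenvalues i) else 0

/-- Partial trace over the first tensor factor. -/
def ptrace₁ {d₁ d₂ : Type} [Fintype d₁] [Fintype d₂] (ρ : Mat (d₁ × d₂)) : Mat d₂ :=
  Matrix.of fun j j' => ∑ i, ρ (i, j) (i, j')

/-- Partial trace over the second tensor factor. -/
def ptrace₂ {d₁ d₂ : Type} [Fintype d₁] [Fintype d₂] (ρ : Mat (d₁ × d₂)) : Mat d₁ :=
  Matrix.of fun i i' => ∑ j, ρ (i, j) (i', j)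

/-- The pure state (rank-one projector) `|v⟩⟨v|`. -/
def pureState {d : Type} [Fintype d] (v : d → ℂ) : Mat d :=
  Matrix.vecMulVec v (star v)

/-- `v` is a unit vector. -/
def UnitVec {d : Type} [Fintype d] (v : d → ℂ) : Prop :=
  ∑ i, ‖v i‖ ^ 2 = 1

/-- Entropy of entanglement of a pure bipartite state. -/
def pureEnt {d₁ d₂ : Type} [Fintype d₁] [Fintype d₂] [DecidableEq d₁]
    (v : d₁ × d₂ → ℂ) : ℝ :=
  entropy (ptrace₂ (pureState v))

/-- Average entanglements of pure-state decompositions of `ρ`. -/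
def efVals {d₁ d₂ : Type} [Fintype d₁] [Fintype d₂] [DecidableEq d₁]
    (ρ : Mat (d₁ × d₂)) : Set ℝ :=
  {x | ∃ (m : ℕ) (p : Fin m → ℝ) (v : Fin m → (d₁ × d₂ → ℂ)),
    (∀ i, 0 ≤ p i) ∧ (∀ i, UnitVec (v i)) ∧
    ρ = ∑ i, (p i : ℂ) • pureState (v i) ∧
    x = ∑ i, p i * pureEnt (v i)}

/-- Entanglement of formation. -/
def Ef {d₁ d₂ : Type} [Fintype d₁] [Fintype d₂] [DecidableEq d₁]
    (ρ : Mat (d₁ × d₂)) : ℝ :=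
  sInf (efVals ρ)

/-- Holevo quantities of pure-state input ensembles for the channel `T`. -/
def capVals {d d₂ : Type} [Fintype d] [Fintype d₂] [DecidableEq d₂]
    (T : Mat d → Mat d₂) : Set ℝ :=
  {x | ∃ (m : ℕ) (p : Fin m → ℝ) (v : Fin m → (d → ℂ)),
    (∀ i, 0 ≤ p i) ∧ (∑ i, p i = 1) ∧ (∀ i, UnitVec (v i)) ∧
    x = entropy (∑ i, (p i : ℂ) • T (pureState (v i)))
        - ∑ i, p i * entropy (T (pureState (v i)))}

/-- Holevo capacity of the channel `T`. -/
def holevoCap {d d₂ : Type} [Fintype d] [Fintype d₂] [DecidableEq d₂]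
    (T : Mat d → Mat d₂) : ℝ :=
  sSup (capVals T)


/-- Tensor product of two bipartite states, regrouped across the
`(H₁⊗H₁'):(H₂⊗H₂')` bipartition. -/
def pairProd {d₁ d₂ d₁' d₂' : Type} [Fintype d₁] [Fintype d₂] [Fintype d₁'] [Fintype d₂']
    (ρ : Mat (d₁ × d₂)) (ρ' : Mat (d₁' × d₂')) : Mat ((d₁ × d₁') × (d₂ × d₂')) :=
  Matrix.of fun a b =>
    ρ (a.1.1, a.2.1) (b.1.1, b.2.1) * ρ' (a.1.2, a.2.2) (b.1.2, b.2.2)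

/-- Marginal of a state on the composite of two bipartite systems on the
first (unprimed) bipartite system. -/
def marg₁ {d₁ d₂ d₁' d₂' : Type} [Fintype d₁] [Fintype d₂] [Fintype d₁'] [Fintype d₂']
    (ω : Mat ((d₁ × d₁') × (d₂ × d₂'))) : Mat (d₁ × d₂) :=
  Matrix.of fun a b => ∑ k : d₁', ∑ l : d₂', ω ((a.1, k), (a.2, l)) ((b.1, k), (b.2, l))

/-- Marginal of a state on the composite of two bipartite systems on the
second (primed) bipartite system. -/
def marg₂ {d₁ d₂ d₁' d₂' : Type} [Fintype d₁] [Fintype d₂] [Fintype d₁'] [Fintype d₂']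
    (ω : Mat ((d₁ × d₁') × (d₂ × d₂'))) : Mat (d₁' × d₂') :=
  Matrix.of fun a b => ∑ k : d₁, ∑ l : d₂, ω ((k, a.1), (l, a.2)) ((k, b.1), (l, b.2))

section Entropy

variable {d a b : Type} [Fintype d] [DecidableEq d] [Fintype a] [DecidableEq a]
  [Fintype b] [DecidableEq b]

/-- The entropy of a Hermitian matrix only depends on the roots of its characteristic
polynomial. -/
lemma entropy_eq_sum_roots {A : Mat d} (hA : A.IsHermitian) :
    entropy A = (A.charpoly.roots.map fun z : ℂ => Real.negMulLog z.re).sum := by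
  rw [entropy, dif_pos hA, hA.roots_charpoly_eq_eigenvalues, Multiset.map_map]
  rfl

lemma entropy_mul_comm (A : Matrix a b ℂ) (B : Matrix b a ℂ)
    (h₁ : (A * B).IsHermitian) (h₂ : (B * A).IsHermitian) :
    entropy (A * B) = entropy (B * A) := by
  have h := congrArg
    (fun p : Polynomial ℂ => (p.roots.map fun z : ℂ => Real.negMulLog z.re).sum)
    (charpoly_mul_comm' A B)
  have aux (n : ℕ) (p : Polynomial ℂ) (hp : p ≠ 0) :
      ((Polynomial.X ^ n * p).roots.map fun z : ℂ => Real.negMulLog z.re).sum =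
        (p.roots.map fun z : ℂ => Real.negMulLog z.re).sum := by
    rw [Polynomial.roots_mul (mul_ne_zero (pow_ne_zero _ Polynomial.X_ne_zero) hp)]
    simp [Multiset.map_nsmul, Multiset.sum_nsmul]
  beta_reduce at h
  rw [aux _ _ (charpoly_monic _).ne_zero, aux _ _ (charpoly_monic _).ne_zero] at h
  rw [entropy_eq_sum_roots h₁, entropy_eq_sum_roots h₂, h]

lemma entropy_transpose {A : Mat d} (hA : A.IsHermitian) : entropy Aᵀ = entropy A := by
  rw [entropy_eq_sum_roots hA, entropy_eq_sum_roots hA.transpose, charpoly_transpose]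

lemma isHermitian_conj_diagonal (V : Mat d) (x : d → ℝ) :
    (V * diagonal (fun i => (x i : ℂ)) * Vᴴ).IsHermitian := by
  apply isHermitian_mul_mul_conjTranspose
  rw [isHermitian_diagonal_iff]
  intro i
  simp [isSelfAdjoint_iff]

lemma entropy_conj_diagonal (V : Mat d) (hV : Vᴴ * V = 1) (x : d → ℝ) :
    entropy (V * diagonal (fun i => (x i : ℂ)) * Vᴴ) = ∑ i, Real.negMulLog (x i) := by
  rw [entropy_eq_sum_roots (isHermitian_conj_diagonal V x), charpoly_mul_comm, ← mul_assoc, hV,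
    one_mul, charpoly_diagonal, Polynomial.roots_prod _ _
      (Finset.prod_ne_zero_iff.2 fun i _ => Polynomial.X_sub_C_ne_zero _)]
  simp

/-- Spectral decomposition of a Hermitian matrix. -/
lemma exists_eq_conj_diagonal {A : Mat d} (hA : A.IsHermitian) :
    ∃ (V : Mat d) (x : d → ℝ), Vᴴ * V = 1 ∧ V * Vᴴ = 1 ∧
      A = V * diagonal (fun i => (x i : ℂ)) * Vᴴ := by
  refine ⟨hA.eigenvectorUnitary, hA.eigenvalues, ?_, ?_, ?_⟩
  · exact Unitary.coe_star_mul_self hA.eigenvectorUnitary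
  · exact Unitary.coe_mul_star_self hA.eigenvectorUnitary
  · exact hA.spectral_theorem

omit [Fintype a] [DecidableEq a] in
lemma conj_diagonal_apply (V : Matrix a b ℂ) (x : b → ℝ) (i : a) :
    (V * diagonal (fun i => (x i : ℂ)) * Vᴴ) i i = ((∑ k, ‖V i k‖ ^ 2 * x k : ℝ) : ℂ) := by
  rw [mul_apply]
  push_cast
  refine Finset.sum_congr rfl fun k _ => ?_
  rw [mul_diagonal, conjTranspose_apply, ← Complex.mul_conj']
  simp only [Complex.star_def]
  ring

omit [DecidableEq a] in
lemma conjTranspose_mul_conj_mul {V : Matrix a b ℂ} (hV : Vᴴ * V = 1) (D : Mat b) :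
    Vᴴ * (V * D * Vᴴ) * V = D := by
  rw [Matrix.mul_assoc, Matrix.mul_assoc _ Vᴴ, hV, Matrix.mul_one, ← Matrix.mul_assoc, hV,
    Matrix.one_mul]

/-- Spectral decomposition of a state. -/
lemma IsState.exists_eq_conj_diagonal {A : Mat d} (hA : IsState A) :
    ∃ (V : Mat d) (x : d → ℝ), Vᴴ * V = 1 ∧ V * Vᴴ = 1 ∧ (∀ i, 0 ≤ x i) ∧ ∑ i, x i = 1 ∧
      A = V * diagonal (fun i => (x i : ℂ)) * Vᴴ := by
  obtain ⟨V, x, h₁, h₂, rfl⟩ := _root_.exists_eq_conj_diagonal hA.1.isHermitian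
  refine ⟨V, x, h₁, h₂, fun i => ?_, ?_, rfl⟩
  · have h := hA.1.conjTranspose_mul_mul_same V
    rw [conjTranspose_mul_conj_mul h₁] at h
    exact Complex.zero_le_real.1 (posSemidef_diagonal_iff.1 h i)
  · have h := hA.2
    rw [trace_mul_cycle, h₁, one_mul, trace_diagonal] at h
    exact_mod_cast h

lemma IsState.entropy_nonneg {A : Mat d} (hA : IsState A) : 0 ≤ entropy A := by
  obtain ⟨V, x, h₁, -, h0, hs, rfl⟩ := hA.exists_eq_conj_diagonal
  rw [entropy_conj_diagonal V h₁]
  exact Finset.sum_nonneg fun i _ => Real.negMulLog_nonneg (h0 i)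
    (hs ▸ Finset.single_le_sum (fun j _ => h0 j) (Finset.mem_univ i))

lemma IsState.entropy_le_card {A : Mat d} (hA : IsState A) : entropy A ≤ Fintype.card d := by
  obtain ⟨V, x, h₁, -, h0, -, rfl⟩ := hA.exists_eq_conj_diagonal
  rw [entropy_conj_diagonal V h₁]
  calc ∑ i, Real.negMulLog (x i) ≤ ∑ _i : d, (1 : ℝ) := Finset.sum_le_sum fun i _ => ?_
    _ = Fintype.card d := by simp
  exact (Real.negMulLog_le_one_sub_self (h0 i)).trans (by linarith [h0 i])

omit [DecidableEq a] [Fintype b] in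
lemma kronecker_conjTranspose_mul_self {U : Matrix a b ℂ} (hU : Uᴴ * U = 1)
    {d d' : Type} [Fintype d] [DecidableEq d] [Fintype d'] [DecidableEq d']
    {V : Matrix d d' ℂ} (hV : Vᴴ * V = 1) : (U ⊗ₖ V)ᴴ * (U ⊗ₖ V) = 1 := by
  rw [conjTranspose_kronecker, ← mul_kronecker_mul, hU, hV, one_kronecker_one]

lemma IsState.entropy_kronecker {A : Mat a} {B : Mat b} (hA : IsState A) (hB : IsState B) :
    entropy (A ⊗ₖ B) = entropy A + entropy B := by
  obtain ⟨V, x, hV, -, -, hx, rfl⟩ := hA.exists_eq_conj_diagonal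
  obtain ⟨W, y, hW, -, -, hy, rfl⟩ := hB.exists_eq_conj_diagonal
  rw [mul_kronecker_mul, mul_kronecker_mul, ← conjTranspose_kronecker, diagonal_kronecker_diagonal]
  have h := entropy_conj_diagonal (V ⊗ₖ W) (kronecker_conjTranspose_mul_self hV hW)
    (fun p : a × b => x p.1 * y p.2)
  push_cast at h
  rw [h, entropy_conj_diagonal V hV, entropy_conj_diagonal W hW, Fintype.sum_prod_type]
  simp only [Real.negMulLog_mul, Finset.sum_add_distrib, ← Finset.sum_mul, ← Finset.mul_sum,
    hx, hy, one_mul]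

end Entropy

section PartialTrace

variable {a b d e : Type} [Fintype a] [Fintype b] [Fintype d] [Fintype e]

/-- A property of matrices on a product that is additive and holds for Kronecker products
holds for all matrices. -/
lemma kronecker_induction {P : Mat (a × b) → Prop} (ρ : Mat (a × b))
    (hadd : ∀ ρ σ, P ρ → P σ → P (ρ + σ)) (hkron : ∀ (X : Mat a) (Y : Mat b), P (X ⊗ₖ Y)) :
    P ρ := by
  classical
  refine Matrix.induction_on' ρ ?_ hadd fun i j x => ?_
  · simpa using hkron 0 0
  · simpa [single_kronecker_single] using hkron (single i.1 j.1 x) (single i.2 j.2 1)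

lemma ptrace₁_add (ρ σ : Mat (a × b)) : ptrace₁ (ρ + σ) = ptrace₁ ρ + ptrace₁ σ := by
  ext; simp [ptrace₁, Finset.sum_add_distrib]

lemma ptrace₂_add (ρ σ : Mat (a × b)) : ptrace₂ (ρ + σ) = ptrace₂ ρ + ptrace₂ σ := by
  ext; simp [ptrace₂, Finset.sum_add_distrib]

lemma ptrace₁_smul (c : ℂ) (ρ : Mat (a × b)) : ptrace₁ (c • ρ) = c • ptrace₁ ρ := by
  ext; simp [ptrace₁, Finset.mul_sum]

lemma ptrace₁_sum {ι : Type*} (s : Finset ι) (ρ : ι → Mat (a × b)) :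
    ptrace₁ (∑ i ∈ s, ρ i) = ∑ i ∈ s, ptrace₁ (ρ i) := by
  ext
  simp only [ptrace₁, of_apply, Matrix.sum_apply]
  exact Finset.sum_comm

lemma ptrace₁_kronecker (X : Mat a) (Y : Mat b) : ptrace₁ (X ⊗ₖ Y) = X.trace • Y := by
  ext; simp [ptrace₁, trace, Finset.sum_mul]

lemma ptrace₂_kronecker (X : Mat a) (Y : Mat b) : ptrace₂ (X ⊗ₖ Y) = Y.trace • X := by
  ext i j
  simp [ptrace₂, trace, ← Finset.mul_sum, mul_comm]

lemma trace_ptrace₁ (ρ : Mat (a × b)) : (ptrace₁ ρ).trace = ρ.trace := by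
  simp only [trace, diag_apply, ptrace₁, of_apply, Fintype.sum_prod_type]
  exact Finset.sum_comm

lemma trace_ptrace₂ (ρ : Mat (a × b)) : (ptrace₂ ρ).trace = ρ.trace := by
  simp only [trace, diag_apply, ptrace₂, of_apply, Fintype.sum_prod_type]

lemma ptrace₁_posSemidef {ρ : Mat (a × b)} (hρ : ρ.PosSemidef) : (ptrace₁ ρ).PosSemidef := by
  have h : ptrace₁ ρ = ∑ i, ρ.submatrix (fun j => (i, j)) (fun j => (i, j)) := by
    ext; simp [ptrace₁, Matrix.sum_apply]
  rw [h]
  exact posSemidef_sum _ fun i _ => hρ.submatrix _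

lemma ptrace₂_posSemidef {ρ : Mat (a × b)} (hρ : ρ.PosSemidef) : (ptrace₂ ρ).PosSemidef := by
  have h : ptrace₂ ρ = ∑ j, ρ.submatrix (fun i => (i, j)) (fun i => (i, j)) := by
    ext; simp [ptrace₂, Matrix.sum_apply]
  rw [h]
  exact posSemidef_sum _ fun i _ => hρ.submatrix _

lemma IsState.isState_ptrace₁ [DecidableEq a] [DecidableEq b] {ρ : Mat (a × b)} (hρ : IsState ρ) :
    IsState (ptrace₁ ρ) :=
  ⟨ptrace₁_posSemidef hρ.1, (trace_ptrace₁ ρ).trans hρ.2⟩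

lemma IsState.isState_ptrace₂ [DecidableEq a] [DecidableEq b] {ρ : Mat (a × b)} (hρ : IsState ρ) :
    IsState (ptrace₂ ρ) :=
  ⟨ptrace₂_posSemidef hρ.1, (trace_ptrace₂ ρ).trans hρ.2⟩

lemma IsState.conj_isometry [DecidableEq a] [DecidableEq b] {ρ : Mat b} (hρ : IsState ρ)
    {U : Matrix a b ℂ} (hU : Uᴴ * U = 1) : IsState (U * ρ * Uᴴ) :=
  ⟨hρ.1.mul_mul_conjTranspose_same U, by rw [trace_mul_cycle, hU, one_mul, hρ.2]⟩

lemma ptrace₁_conj_kronecker [DecidableEq a] (U : Matrix d a ℂ) (hU : Uᴴ * U = 1)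
    (V : Matrix e b ℂ) (ρ : Mat (a × b)) :
    ptrace₁ ((U ⊗ₖ V) * ρ * (U ⊗ₖ V)ᴴ) = V * ptrace₁ ρ * Vᴴ := by
  induction ρ using kronecker_induction with
  | hadd ρ σ h₁ h₂ => simp only [Matrix.mul_add, Matrix.add_mul, ptrace₁_add, h₁, h₂]
  | hkron X Y =>
    rw [conjTranspose_kronecker, ← mul_kronecker_mul, ← mul_kronecker_mul, ptrace₁_kronecker,
      ptrace₁_kronecker, trace_mul_cycle, hU, Matrix.one_mul, Matrix.mul_smul, Matrix.smul_mul]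

lemma ptrace₂_conj_kronecker [DecidableEq b] (U : Matrix d a ℂ)
    (V : Matrix e b ℂ) (hV : Vᴴ * V = 1) (ρ : Mat (a × b)) :
    ptrace₂ ((U ⊗ₖ V) * ρ * (U ⊗ₖ V)ᴴ) = U * ptrace₂ ρ * Uᴴ := by
  induction ρ using kronecker_induction with
  | hadd ρ σ h₁ h₂ => simp only [Matrix.mul_add, Matrix.add_mul, ptrace₂_add, h₁, h₂]
  | hkron X Y =>
    rw [conjTranspose_kronecker, ← mul_kronecker_mul, ← mul_kronecker_mul, ptrace₂_kronecker,
      ptrace₂_kronecker, trace_mul_cycle V, hV, Matrix.one_mul, Matrix.mul_smul, Matrix.smul_mul]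

lemma ptrace₁_marg₁ (ω : Mat ((a × d) × (b × e))) : ptrace₁ (marg₁ ω) = ptrace₂ (ptrace₁ ω) := by
  ext i j
  simp only [ptrace₁, ptrace₂, marg₁, of_apply, Fintype.sum_prod_type]
  exact (Finset.sum_congr rfl fun _ _ => Finset.sum_comm).trans Finset.sum_comm

lemma ptrace₁_marg₂ (ω : Mat ((a × d) × (b × e))) : ptrace₁ (marg₂ ω) = ptrace₁ (ptrace₁ ω) := by
  ext i j
  simp only [ptrace₁, marg₂, of_apply, Fintype.sum_prod_type]
  exact ((Finset.sum_congr rfl fun _ _ => Finset.sum_comm).trans Finset.sum_comm).trans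
    (Finset.sum_congr rfl fun _ _ => Finset.sum_comm)

end PartialTrace

section Subadditivity

/-- A scalar form of Klein's inequality. -/
lemma mul_log_add_negMulLog_le {x y : ℝ} (hx : 0 ≤ x) (hy : 0 ≤ y) (h : y = 0 → x = 0) :
    x * Real.log y + Real.negMulLog x ≤ y - x := by
  rcases hx.eq_or_lt with rfl | hx
  · simpa using hy
  have hy' : 0 < y := hy.lt_of_ne fun h0 => hx.ne' (h h0.symm)
  have h1 := mul_le_mul_of_nonneg_left (Real.log_le_sub_one_of_pos (div_pos hy' hx)) hx.le
  rw [Real.log_div hy'.ne' hx.ne', mul_sub, mul_sub, mul_div_cancel₀ _ hx.ne'] at h1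
  rw [Real.negMulLog]
  linarith

/-- Subadditivity of the von Neumann entropy. -/
lemma IsState.entropy_subadditive {a b : Type} [Fintype a] [Fintype b] [DecidableEq a]
    [DecidableEq b] {ρ : Mat (a × b)} (hρ : IsState ρ) :
    entropy ρ ≤ entropy (ptrace₂ ρ) + entropy (ptrace₁ ρ) := by
  obtain ⟨V, α, hV, hV', hα0, hα1, hα⟩ := hρ.isState_ptrace₂.exists_eq_conj_diagonal
  obtain ⟨W, β, hW, hW', hβ0, hβ1, hβ⟩ := hρ.isState_ptrace₁.exists_eq_conj_diagonal
  obtain ⟨E, l, hE, -, hl0, -, hl⟩ := hρ.exists_eq_conj_diagonal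
  set F : Mat (a × b) := (Vᴴ ⊗ₖ Wᴴ) * E with hF
  have hK : (Vᴴ ⊗ₖ Wᴴ)ᴴ * (Vᴴ ⊗ₖ Wᴴ) = 1 :=
    kronecker_conjTranspose_mul_self (by simpa using hV') (by simpa using hW')
  have hF₁ : Fᴴ * F = 1 := by
    rw [hF, conjTranspose_mul, mul_assoc, ← mul_assoc _ _ E, hK, one_mul, hE]
  have hF₂ : F * Fᴴ = 1 := mul_eq_one_comm.1 hF₁
  have hcol (k : a × b) : ∑ p, ‖F p k‖ ^ 2 = 1 := by
    have h := congrFun (congrFun hF₁ k) k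
    rw [mul_apply, one_apply_eq] at h
    simp only [conjTranspose_apply, Complex.star_def, Complex.conj_mul'] at h
    exact_mod_cast h
  have hrow (p : a × b) : ∑ k, ‖F p k‖ ^ 2 = 1 := by
    have h := congrFun (congrFun hF₂ p) p
    rw [mul_apply, one_apply_eq] at h
    simp only [conjTranspose_apply, Complex.star_def, Complex.mul_conj'] at h
    exact_mod_cast h
  have hQ : (Vᴴ ⊗ₖ Wᴴ) * ρ * (Vᴴ ⊗ₖ Wᴴ)ᴴ = F * diagonal (fun k => (l k : ℂ)) * Fᴴ := by
    rw [hl, hF, conjTranspose_mul]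
    simp only [mul_assoc]
  have hqα (i : a) : ∑ j, ∑ k, ‖F (i, j) k‖ ^ 2 * l k = α i := by
    have h := ptrace₂_conj_kronecker Vᴴ Wᴴ (by simpa using hW') ρ
    rw [hα, hQ, conjTranspose_conjTranspose, conjTranspose_mul_conj_mul hV] at h
    have h := congrFun (congrFun h i) i
    simp only [ptrace₂, of_apply, conj_diagonal_apply, diagonal_apply_eq] at h
    exact_mod_cast h
  have hqβ (j : b) : ∑ i, ∑ k, ‖F (i, j) k‖ ^ 2 * l k = β j := by
    have h := ptrace₁_conj_kronecker Vᴴ (by simpa using hV') Wᴴ ρ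
    rw [hβ, hQ, conjTranspose_conjTranspose, conjTranspose_mul_conj_mul hW] at h
    have h := congrFun (congrFun h j) j
    simp only [ptrace₁, of_apply, conj_diagonal_apply, diagonal_apply_eq] at h
    exact_mod_cast h
  have hnn (p k : a × b) : 0 ≤ ‖F p k‖ ^ 2 * l k := mul_nonneg (sq_nonneg _) (hl0 k)
  have hzα (i : a) (h : α i = 0) (j : b) (k : a × b) : ‖F (i, j) k‖ ^ 2 * l k = 0 := by
    rw [← hqα, Finset.sum_eq_zero_iff_of_nonneg
      fun j _ => Finset.sum_nonneg fun k _ => hnn _ _] at h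
    exact (Finset.sum_eq_zero_iff_of_nonneg fun k _ => hnn _ _).1 (h j (Finset.mem_univ _)) k
      (Finset.mem_univ _)
  have hzβ (j : b) (h : β j = 0) (i : a) (k : a × b) : ‖F (i, j) k‖ ^ 2 * l k = 0 := by
    rw [← hqβ, Finset.sum_eq_zero_iff_of_nonneg
      fun j _ => Finset.sum_nonneg fun k _ => hnn _ _] at h
    exact (Finset.sum_eq_zero_iff_of_nonneg fun k _ => hnn _ _).1 (h i (Finset.mem_univ _)) k
      (Finset.mem_univ _)
  have hterm (i : a) (j : b) (k : a × b) :
      ‖F (i, j) k‖ ^ 2 * Real.negMulLog (l k) + ‖F (i, j) k‖ ^ 2 * l k * Real.log (α i)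
        + ‖F (i, j) k‖ ^ 2 * l k * Real.log (β j)
        ≤ ‖F (i, j) k‖ ^ 2 * (α i * β j) - ‖F (i, j) k‖ ^ 2 * l k := by
    rcases eq_or_ne (‖F (i, j) k‖ ^ 2) 0 with h0 | h0
    · simp [h0]
    have hα' : α i = 0 → l k = 0 := fun h => (mul_eq_zero.1 (hzα i h j k)).resolve_left h0
    have hβ' : β j = 0 → l k = 0 := fun h => (mul_eq_zero.1 (hzβ j h i k)).resolve_left h0
    have h := mul_le_mul_of_nonneg_left (mul_log_add_negMulLog_le (hl0 k)
      (mul_nonneg (hα0 i) (hβ0 j)) fun h => (mul_eq_zero.1 h).elim hα' hβ')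
      (sq_nonneg ‖F (i, j) k‖)
    have hlog : l k * Real.log (α i * β j) = l k * Real.log (α i) + l k * Real.log (β j) := by
      by_cases hlk : l k = 0
      · simp [hlk]
      · rw [Real.log_mul (fun h => hlk (hα' h)) (fun h => hlk (hβ' h)), mul_add]
    rw [hlog] at h
    linarith
  have hsum := Finset.sum_le_sum fun i (_ : i ∈ Finset.univ) =>
    Finset.sum_le_sum fun j (_ : j ∈ Finset.univ) =>
      Finset.sum_le_sum fun k (_ : k ∈ Finset.univ) => hterm i j k
  simp only [Finset.sum_add_distrib, Finset.sum_sub_distrib] at hsum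
  have e₁ : ∑ i, ∑ j, ∑ k, ‖F (i, j) k‖ ^ 2 * Real.negMulLog (l k)
      = ∑ k, Real.negMulLog (l k) := by
    rw [← Fintype.sum_prod_type' (f := fun i j => ∑ k, ‖F (i, j) k‖ ^ 2 * Real.negMulLog (l k)),
      Finset.sum_comm]
    exact Finset.sum_congr rfl fun k _ => by rw [← Finset.sum_mul, hcol, one_mul]
  have e₂ : ∑ i, ∑ j, ∑ k, ‖F (i, j) k‖ ^ 2 * l k * Real.log (α i)
      = -∑ i, Real.negMulLog (α i) := by
    rw [← Finset.sum_neg_distrib]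
    exact Finset.sum_congr rfl fun i _ => by simp only [← Finset.sum_mul, hqα, Real.negMulLog]; ring
  have e₃ : ∑ i, ∑ j, ∑ k, ‖F (i, j) k‖ ^ 2 * l k * Real.log (β j)
      = -∑ j, Real.negMulLog (β j) := by
    rw [Finset.sum_comm, ← Finset.sum_neg_distrib]
    exact Finset.sum_congr rfl fun i _ => by simp only [← Finset.sum_mul, hqβ, Real.negMulLog]; ring
  have e₄ : ∑ i, ∑ j, ∑ k, ‖F (i, j) k‖ ^ 2 * (α i * β j) = 1 := by
    simp only [← Finset.sum_mul, hrow, one_mul, ← Finset.mul_sum, hβ1, mul_one, hα1]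
  have e₅ : ∑ i, ∑ j, ∑ k, ‖F (i, j) k‖ ^ 2 * l k = 1 := by
    simp only [hqα, hα1]
  rw [hα, hβ, entropy_conj_diagonal V hV, entropy_conj_diagonal W hW]
  conv_lhs => rw [hl, entropy_conj_diagonal E hE]
  linarith

end Subadditivity

section PureState

variable {a b : Type} [Fintype a] [Fintype b]

lemma pureState_mulVec (U : Matrix a b ℂ) (v : b → ℂ) :
    pureState (U *ᵥ v) = U * pureState v * Uᴴ := by
  rw [pureState, pureState, star_mulVec, mul_vecMulVec, vecMulVec_mul]

lemma trace_pureState (v : a → ℂ) : (pureState v).trace = ((∑ i, ‖v i‖ ^ 2 : ℝ) : ℂ) := by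
  simp [pureState, trace, vecMulVec_apply, Complex.mul_conj']

lemma UnitVec.isState_pureState [DecidableEq a] {v : a → ℂ} (hv : UnitVec v) :
    IsState (pureState v) :=
  ⟨posSemidef_vecMulVec_self_star v, by rw [trace_pureState, hv, Complex.ofReal_one]⟩

lemma UnitVec.of_trace {v : a → ℂ} (hv : (pureState v).trace = 1) : UnitVec v := by
  rw [trace_pureState] at hv
  exact_mod_cast hv

lemma UnitVec.trace {v : a → ℂ} (hv : UnitVec v) : (pureState v).trace = 1 := by
  rw [trace_pureState, hv, Complex.ofReal_one]

lemma UnitVec.mulVec [DecidableEq b] {v : b → ℂ} (hv : UnitVec v) {U : Matrix a b ℂ}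
    (hU : Uᴴ * U = 1) : UnitVec (U *ᵥ v) :=
  .of_trace (by rw [pureState_mulVec, trace_mul_cycle, hU, Matrix.one_mul, hv.trace])

lemma unitVec_single [DecidableEq a] (i : a) : UnitVec (Pi.single i 1 : a → ℂ) := by
  rw [UnitVec, Finset.sum_eq_single i]
  · simp
  · intro j _ hj
    simp [hj]
  · simp

lemma isState_sum_smul [DecidableEq a] {ι : Type*} [Fintype ι] {p : ι → ℝ} {ρ : ι → Mat a}
    (hp : ∀ i, 0 ≤ p i) (hs : ∑ i, p i = 1) (hρ : ∀ i, IsState (ρ i)) :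
    IsState (∑ i, (p i : ℂ) • ρ i) := by
  refine ⟨posSemidef_sum _ fun i _ => (hρ i).1.smul (Complex.zero_le_real.2 (hp i)), ?_⟩
  simp only [trace_sum, trace_smul, (hρ _).2, smul_eq_mul, mul_one]
  exact_mod_cast hs

/-- The two marginals of a pure state have the same entropy. -/
lemma entropy_ptrace₁_pureState [DecidableEq a] [DecidableEq b] (v : a × b → ℂ) :
    entropy (ptrace₁ (pureState v)) = pureEnt v := by
  let M : Matrix a b ℂ := of fun i j => v (i, j)
  have h₁ : ptrace₁ (pureState v) = (Mᴴ * M)ᵀ := by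
    ext i j
    simp [ptrace₁, pureState, M, vecMulVec_apply, mul_apply, mul_comm]
  have h₂ : ptrace₂ (pureState v) = M * Mᴴ := by
    ext i j
    simp [ptrace₂, pureState, M, vecMulVec_apply, mul_apply]
  rw [pureEnt, h₁, h₂, entropy_transpose (isHermitian_conjTranspose_mul_self M),
    entropy_mul_comm _ _ (isHermitian_conjTranspose_mul_self M)
      (isHermitian_mul_conjTranspose_self M)]

/-- Every state has a decomposition into pure states. -/
lemma IsState.exists_eq_sum_pureState [DecidableEq a] {ρ : Mat a} (hρ : IsState ρ) :
    ∃ (m : ℕ) (p : Fin m → ℝ) (v : Fin m → (a → ℂ)),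
      (∀ i, 0 ≤ p i) ∧ (∀ i, UnitVec (v i)) ∧ ρ = ∑ i, (p i : ℂ) • pureState (v i) := by
  obtain ⟨V, x, hV, -, h0, -, rfl⟩ := hρ.exists_eq_conj_diagonal
  refine ⟨Fintype.card a, fun i => x ((Fintype.equivFin a).symm i),
    fun i => V *ᵥ Pi.single ((Fintype.equivFin a).symm i) 1, fun i => h0 _,
    fun i => (unitVec_single _).mulVec hV, ?_⟩
  rw [(Fintype.equivFin a).symm.sum_comp
    (fun i => (x i : ℂ) • pureState (V *ᵥ Pi.single i 1))]
  ext i j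
  rw [mul_apply, Matrix.sum_apply]
  refine Finset.sum_congr rfl fun k _ => ?_
  simp only [mul_diagonal, pureState, Matrix.smul_apply, vecMulVec_apply, mulVec_single_one,
    col_apply, conjTranspose_apply, Pi.star_apply, smul_eq_mul]
  ring

lemma bddBelow_efVals [DecidableEq a] [DecidableEq b] (ρ : Mat (a × b)) :
    BddBelow (efVals ρ) := by
  refine ⟨0, ?_⟩
  rintro x ⟨m, p, v, hp, hv, -, rfl⟩
  exact Finset.sum_nonneg fun i _ => mul_nonneg (hp i)
    (hv i).isState_pureState.isState_ptrace₂.entropy_nonneg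

/-- If a mixture of pure states is supported on the range of an isometry, then so is each
vector of positive weight. -/
lemma mulVec_conjTranspose_mulVec_of_sum_pureState [DecidableEq a] [DecidableEq b]
    {U : Matrix a b ℂ}
    (hU : Uᴴ * U = 1) {σ : Mat b} {ι : Type*} [Fintype ι] {p : ι → ℝ} {v : ι → a → ℂ}
    (hp : ∀ i, 0 ≤ p i) (h : U * σ * Uᴴ = ∑ i, (p i : ℂ) • pureState (v i)) {i : ι}
    (hi : p i ≠ 0) : U *ᵥ (Uᴴ *ᵥ v i) = v i := by
  set R : Mat a := 1 - U * Uᴴ with hR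
  have hRU : R * U = 0 := by
    rw [hR, Matrix.sub_mul, Matrix.mul_assoc, hU, Matrix.mul_one, Matrix.one_mul, sub_self]
  have h0 : ∑ i, (p i : ℂ) • pureState (R *ᵥ v i) = 0 := by
    calc ∑ i, (p i : ℂ) • pureState (R *ᵥ v i)
        = R * (∑ i, (p i : ℂ) • pureState (v i)) * Rᴴ := by
          simp only [pureState_mulVec, Matrix.mul_sum, Matrix.sum_mul, Matrix.mul_smul,
            Matrix.smul_mul]
      _ = 0 := by
          rw [← h, ← Matrix.mul_assoc, ← Matrix.mul_assoc, hRU]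
          simp
  have h1 := congrArg Matrix.trace h0
  simp only [trace_sum, trace_smul, trace_pureState, smul_eq_mul, trace_zero] at h1
  have h2 : ∑ i, p i * ∑ j, ‖(R *ᵥ v i) j‖ ^ 2 = 0 := by exact_mod_cast h1
  have hnn (i : ι) : 0 ≤ ∑ j, ‖(R *ᵥ v i) j‖ ^ 2 := Finset.sum_nonneg fun j _ => sq_nonneg _
  rw [Finset.sum_eq_zero_iff_of_nonneg fun i _ => mul_nonneg (hp i) (hnn i)] at h2
  have h3 := (mul_eq_zero.1 (h2 i (Finset.mem_univ _))).resolve_left hi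
  rw [Finset.sum_eq_zero_iff_of_nonneg fun j _ => sq_nonneg _] at h3
  have h4 : R *ᵥ v i = 0 := funext fun j => by simpa using h3 j (Finset.mem_univ _)
  rw [hR, sub_mulVec, one_mulVec, sub_eq_zero] at h4
  rw [mulVec_mulVec, ← h4]

end PureState

section Capacity

variable {d d₁ d₂ : Type} [Fintype d] [Fintype d₁] [Fintype d₂] [DecidableEq d]
  [DecidableEq d₁] [DecidableEq d₂]
  {U : Matrix (d₁ × d₂) d ℂ} {T : Mat d → Mat d₂}

lemma IsState.map_channel (hU : Uᴴ * U = 1) (hT : ∀ σ : Mat d, T σ = ptrace₁ (U * σ * Uᴴ))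
    {σ : Mat d} (hσ : IsState σ) : IsState (T σ) := by
  rw [hT]
  exact (hσ.conj_isometry hU).isState_ptrace₁

omit [DecidableEq d] [DecidableEq d₁] [DecidableEq d₂] in
lemma channel_sum_smul (hT : ∀ σ : Mat d, T σ = ptrace₁ (U * σ * Uᴴ)) {ι : Type*} [Fintype ι]
    (c : ι → ℂ) (σ : ι → Mat d) : T (∑ i, c i • σ i) = ∑ i, c i • T (σ i) := by
  simp only [hT, Matrix.mul_sum, Matrix.sum_mul, Matrix.mul_smul, Matrix.smul_mul, ptrace₁_sum,
    ptrace₁_smul]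

omit [DecidableEq d] in
lemma channel_pureState (hT : ∀ σ : Mat d, T σ = ptrace₁ (U * σ * Uᴴ)) (v : d → ℂ) :
    entropy (T (pureState v)) = pureEnt (U *ᵥ v) := by
  rw [hT, ← pureState_mulVec, entropy_ptrace₁_pureState]

lemma bddAbove_capVals (hU : Uᴴ * U = 1) (hT : ∀ σ : Mat d, T σ = ptrace₁ (U * σ * Uᴴ)) :
    BddAbove (capVals T) := by
  refine ⟨Fintype.card d₂, ?_⟩
  rintro x ⟨m, p, v, hp, hs, hv, rfl⟩
  have hst (i) := (hv i).isState_pureState.map_channel hU hT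
  have h1 := (isState_sum_smul hp hs hst).entropy_le_card
  have h2 : 0 ≤ ∑ i, p i * entropy (T (pureState (v i))) :=
    Finset.sum_nonneg fun i _ => mul_nonneg (hp i) (hst i).entropy_nonneg
  linarith

lemma capVals_nonempty [Nonempty d] (T : Mat d → Mat d₂) : (capVals T).Nonempty :=
  ⟨_, 1, fun _ => 1, fun _ => Pi.single (Classical.arbitrary d) 1, fun _ => zero_le_one,
    by simp, fun _ => unitVec_single _, rfl⟩

omit [DecidableEq d] in
/-- Holevo quantities may be computed with ensembles indexed by any finite type. -/
lemma mem_capVals {ι : Type*} [Fintype ι] {p : ι → ℝ} {v : ι → d → ℂ} (hp : ∀ i, 0 ≤ p i)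
    (hs : ∑ i, p i = 1) (hv : ∀ i, UnitVec (v i)) :
    entropy (∑ i, (p i : ℂ) • T (pureState (v i))) - ∑ i, p i * entropy (T (pureState (v i)))
      ∈ capVals T := by
  let e := (Fintype.equivFin ι).symm
  refine ⟨Fintype.card ι, p ∘ e, v ∘ e, fun i => hp _, ?_, fun i => hv _, ?_⟩
  · simpa using (e.sum_comp p).trans hs
  · simp only [Function.comp_apply]
    rw [e.sum_comp (fun i => (p i : ℂ) • T (pureState (v i))),
      e.sum_comp (fun i => p i * entropy (T (pureState (v i))))]

/-- The output entropy minus the entanglement of formation of the dilated state is bounded by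
the Holevo capacity. -/
lemma IsState.entropy_sub_Ef_le_holevoCap [Nonempty d] (hU : Uᴴ * U = 1)
    (hT : ∀ σ : Mat d, T σ = ptrace₁ (U * σ * Uᴴ)) {σ : Mat d} (hσ : IsState σ) :
    entropy (T σ) - Ef (U * σ * Uᴴ) ≤ holevoCap T := by
  have hst := hσ.conj_isometry hU
  suffices h : entropy (T σ) - holevoCap T ≤ Ef (U * σ * Uᴴ) by linarith
  refine le_csInf ?_ ?_
  · obtain ⟨m, p, v, hp, hv, h⟩ := hst.exists_eq_sum_pureState
    exact ⟨_, m, p, v, hp, hv, h, rfl⟩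
  rintro x ⟨m, p, v, hp, hv, h, rfl⟩
  have hs : ∑ i, p i = 1 := by
    have h1 := hst.2
    simp only [h, trace_sum, trace_smul, (hv _).trace, smul_eq_mul, mul_one] at h1
    exact_mod_cast h1
  let u (i : Fin m) : d → ℂ :=
    if p i = 0 then Pi.single (Classical.arbitrary d) 1 else Uᴴ *ᵥ v i
  have hUu (i : Fin m) (hi : p i ≠ 0) : U *ᵥ u i = v i := by
    simp only [u, if_neg hi]
    exact mulVec_conjTranspose_mulVec_of_sum_pureState hU hp h hi
  have hu (i : Fin m) : UnitVec (u i) := by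
    by_cases hi : p i = 0
    · simp only [u, if_pos hi]
      exact unitVec_single _
    · refine .of_trace ?_
      rw [← (hv i).trace, ← hUu i hi, pureState_mulVec, trace_mul_cycle, hU, Matrix.one_mul]
  have h1 : ∑ i, (p i : ℂ) • T (pureState (u i)) = T σ := by
    rw [hT σ, h, ptrace₁_sum]
    refine Finset.sum_congr rfl fun i _ => ?_
    by_cases hi : p i = 0
    · rw [ptrace₁_smul]
      simp [hi]
    · rw [hT, ← pureState_mulVec, hUu i hi, ptrace₁_smul]
  have h2 : ∑ i, p i * entropy (T (pureState (u i))) = ∑ i, p i * pureEnt (v i) := by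
    refine Finset.sum_congr rfl fun i _ => ?_
    by_cases hi : p i = 0
    · simp [hi]
    · rw [channel_pureState hT, hUu i hi]
  have h3 := le_csSup (bddAbove_capVals hU hT) (mem_capVals (T := T) hp hs hu)
  rw [h1, h2] at h3
  rw [holevoCap]
  linarith

end Capacity

section Tensor

variable {d d₁ d₂ d' d₁' d₂' : Type}
  [Fintype d] [Fintype d₁] [Fintype d₂] [Fintype d'] [Fintype d₁'] [Fintype d₂']

variable (U : Matrix (d₁ × d₂) d ℂ) (U' : Matrix (d₁' × d₂') d' ℂ)

lemma marg₁_pairProd (A : Mat (d₁ × d₂)) (B : Mat (d₁' × d₂')) :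
    marg₁ (pairProd A B) = B.trace • A := by
  ext i j
  simp [marg₁, pairProd, trace, Fintype.sum_prod_type, ← Finset.mul_sum, mul_comm]

lemma marg₂_pairProd (A : Mat (d₁ × d₂)) (B : Mat (d₁' × d₂')) :
    marg₂ (pairProd A B) = A.trace • B := by
  ext i j
  simp [marg₂, pairProd, trace, Fintype.sum_prod_type, ← Finset.sum_mul]

lemma ptrace₁_pairProd (A : Mat (d₁ × d₂)) (B : Mat (d₁' × d₂')) :
    ptrace₁ (pairProd A B) = ptrace₁ A ⊗ₖ ptrace₁ B := by
  ext i j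
  simp [ptrace₁, pairProd, Fintype.sum_prod_type, Finset.sum_mul_sum]

lemma marg₁_add (ρ σ : Mat ((d₁ × d₁') × (d₂ × d₂'))) :
    marg₁ (ρ + σ) = marg₁ ρ + marg₁ σ := by
  ext; simp [marg₁, Finset.sum_add_distrib]

lemma marg₂_add (ρ σ : Mat ((d₁ × d₁') × (d₂ × d₂'))) :
    marg₂ (ρ + σ) = marg₂ ρ + marg₂ σ := by
  ext; simp [marg₂, Finset.sum_add_distrib]

/-- The tensor product of two dilation isometries, regrouped across the bipartition. -/
abbrev tensorDilation : Matrix ((d₁ × d₁') × (d₂ × d₂')) (d × d') ℂ :=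
  (U ⊗ₖ U').submatrix (Equiv.prodProdProdComm d₁ d₂ d₁' d₂').symm id

lemma tensorDilation_conj_kronecker (X : Mat d) (Y : Mat d') :
    tensorDilation U U' * (X ⊗ₖ Y) * (tensorDilation U U')ᴴ =
      pairProd (U * X * Uᴴ) (U' * Y * U'ᴴ) := by
  have h : tensorDilation U U' * (X ⊗ₖ Y) * (tensorDilation U U')ᴴ =
      ((U ⊗ₖ U') * (X ⊗ₖ Y) * (U ⊗ₖ U')ᴴ).submatrix
        (Equiv.prodProdProdComm d₁ d₂ d₁' d₂').symm
        (Equiv.prodProdProdComm d₁ d₂ d₁' d₂').symm := rfl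
  rw [h, conjTranspose_kronecker, ← mul_kronecker_mul, ← mul_kronecker_mul]
  rfl

variable {U U'} [DecidableEq d] [DecidableEq d']

omit [Fintype d] [Fintype d'] in
lemma tensorDilation_conjTranspose_mul_self (hU : Uᴴ * U = 1) (hU' : U'ᴴ * U' = 1) :
    (tensorDilation U U')ᴴ * tensorDilation U U' = 1 := by
  rw [conjTranspose_submatrix, submatrix_mul_equiv, conjTranspose_kronecker, ← mul_kronecker_mul,
    hU, hU', one_kronecker_one, submatrix_id_id]

omit [DecidableEq d] in
lemma marg₁_conj_tensorDilation (hU' : U'ᴴ * U' = 1) (σ : Mat (d × d')) :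
    marg₁ (tensorDilation U U' * σ * (tensorDilation U U')ᴴ) = U * ptrace₂ σ * Uᴴ := by
  induction σ using kronecker_induction with
  | hadd ρ σ h₁ h₂ => simp only [Matrix.mul_add, Matrix.add_mul, marg₁_add, ptrace₂_add, h₁, h₂]
  | hkron X Y =>
    rw [tensorDilation_conj_kronecker, marg₁_pairProd, ptrace₂_kronecker, trace_mul_cycle U', hU',
      Matrix.one_mul, Matrix.mul_smul, Matrix.smul_mul]

omit [DecidableEq d'] in
lemma marg₂_conj_tensorDilation (hU : Uᴴ * U = 1) (σ : Mat (d × d')) :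
    marg₂ (tensorDilation U U' * σ * (tensorDilation U U')ᴴ) = U' * ptrace₁ σ * U'ᴴ := by
  induction σ using kronecker_induction with
  | hadd ρ σ h₁ h₂ => simp only [Matrix.mul_add, Matrix.add_mul, marg₂_add, ptrace₁_add, h₁, h₂]
  | hkron X Y =>
    rw [tensorDilation_conj_kronecker, marg₂_pairProd, ptrace₁_kronecker, trace_mul_cycle U, hU,
      Matrix.one_mul, Matrix.mul_smul, Matrix.smul_mul]

omit [DecidableEq d] [DecidableEq d'] in
lemma pureState_mul (v : d → ℂ) (w : d' → ℂ) :
    pureState (fun i : d × d' => v i.1 * w i.2) = pureState v ⊗ₖ pureState w := by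
  ext i j
  simp [pureState, vecMulVec_apply]
  ring

omit [DecidableEq d] [DecidableEq d'] in
lemma UnitVec.mul {v : d → ℂ} {w : d' → ℂ} (hv : UnitVec v) (hw : UnitVec w) :
    UnitVec (fun i : d × d' => v i.1 * w i.2) :=
  .of_trace (by rw [pureState_mul, trace_kronecker, hv.trace, hw.trace, one_mul])

variable [DecidableEq d₁] [DecidableEq d₂] [DecidableEq d₁'] [DecidableEq d₂']
  {T : Mat d → Mat d₂} {T' : Mat d' → Mat d₂'} {T₂ : Mat (d × d') → Mat (d₂ × d₂')}

lemma add_mem_capVals (hU : Uᴴ * U = 1) (hU' : U'ᴴ * U' = 1)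
    (hT : ∀ σ : Mat d, T σ = ptrace₁ (U * σ * Uᴴ))
    (hT' : ∀ σ : Mat d', T' σ = ptrace₁ (U' * σ * U'ᴴ))
    (hT₂ : ∀ σ : Mat (d × d'),
      T₂ σ = ptrace₁ (tensorDilation U U' * σ * (tensorDilation U U')ᴴ))
    {x y : ℝ} (hx : x ∈ capVals T) (hy : y ∈ capVals T') : x + y ∈ capVals T₂ := by
  obtain ⟨m, p, v, hp, hps, hv, rfl⟩ := hx
  obtain ⟨n, q, w, hq, hqs, hw, rfl⟩ := hy
  have hprod (i : Fin m) (j : Fin n) :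
      T₂ (pureState fun k : d × d' => v i k.1 * w j k.2) =
        T (pureState (v i)) ⊗ₖ T' (pureState (w j)) := by
    rw [pureState_mul, hT₂, tensorDilation_conj_kronecker, ptrace₁_pairProd, ← hT, ← hT']
  have hTv (i) := (hv i).isState_pureState.map_channel hU hT
  have hTw (j) := (hw j).isState_pureState.map_channel hU' hT'
  have key := mem_capVals (T := T₂) (ι := Fin m × Fin n) (p := fun i => p i.1 * q i.2)
    (v := fun i k => v i.1 k.1 * w i.2 k.2) (fun i => mul_nonneg (hp _) (hq _))
    (by rw [Fintype.sum_prod_type]; simp only [← Finset.mul_sum, hqs, mul_one, hps])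
    (fun i => (hv _).mul (hw _))
  have h1 : ∑ i : Fin m × Fin n, ((p i.1 * q i.2 : ℝ) : ℂ) •
      (T (pureState (v i.1)) ⊗ₖ T' (pureState (w i.2))) =
      (∑ i, (p i : ℂ) • T (pureState (v i))) ⊗ₖ (∑ j, (q j : ℂ) • T' (pureState (w j))) := by
    ext a b
    simp only [Matrix.sum_apply, kroneckerMap_apply, Matrix.smul_apply, smul_eq_mul,
      Finset.sum_mul_sum, Fintype.sum_prod_type, Complex.ofReal_mul]
    exact Finset.sum_congr rfl fun i _ => Finset.sum_congr rfl fun j _ => by ring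
  have h2 : ∑ i : Fin m × Fin n, p i.1 * q i.2 *
      (entropy (T (pureState (v i.1))) + entropy (T' (pureState (w i.2)))) =
      ∑ i, p i * entropy (T (pureState (v i))) + ∑ j, q j * entropy (T' (pureState (w j))) := by
    calc _ = (∑ i, p i * entropy (T (pureState (v i)))) * (∑ j, q j) +
        (∑ i, p i) * ∑ j, q j * entropy (T' (pureState (w j))) := by
          simp only [Finset.sum_mul_sum, Fintype.sum_prod_type, ← Finset.sum_add_distrib]
          exact Finset.sum_congr rfl fun i _ => Finset.sum_congr rfl fun j _ => by ring
      _ = _ := by rw [hps, hqs, mul_one, one_mul]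
  simp only [hprod, (hTv _).entropy_kronecker (hTw _)] at key
  rw [h1, h2, (isState_sum_smul hp hps hTv).entropy_kronecker (isState_sum_smul hq hqs hTw)]
    at key
  convert key using 1
  ring

end Tensor

theorem stmt7
    {d d₁ d₂ d' d₁' d₂' : Type}
    [Fintype d] [Fintype d₁] [Fintype d₂] [Fintype d'] [Fintype d₁'] [Fintype d₂']
    [DecidableEq d] [DecidableEq d₁] [DecidableEq d₂]
    [DecidableEq d'] [DecidableEq d₁'] [DecidableEq d₂']
    [Nonempty d] [Nonempty d']
    (U : Matrix (d₁ × d₂) d ℂ) (hU : Uᴴ * U = 1)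
    (U' : Matrix (d₁' × d₂') d' ℂ) (hU' : U'ᴴ * U' = 1)
    (T : Mat d → Mat d₂) (hT : ∀ σ : Mat d, T σ = ptrace₁ (U * σ * Uᴴ))
    (T' : Mat d' → Mat d₂') (hT' : ∀ σ : Mat d', T' σ = ptrace₁ (U' * σ * U'ᴴ))
    (W : Matrix ((d₁ × d₁') × (d₂ × d₂')) (d × d') ℂ)
    (hW : W = (Matrix.reindex (Equiv.prodProdProdComm d₁ d₂ d₁' d₂')
        (Equiv.refl (d × d'))) (U ⊗ₖ U'))
    (T₂ : Mat (d × d') → Mat (d₂ × d₂'))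
    (hT₂ : ∀ σ : Mat (d × d'), T₂ σ = ptrace₁ (W * σ * Wᴴ))
    (hsuper : ∀ ω : Mat ((d₁ × d₁') × (d₂ × d₂')), IsState ω →
      Ef ω ≥ Ef (marg₁ ω) + Ef (marg₂ ω)) :
    holevoCap T₂ = holevoCap T + holevoCap T' := by
  replace hW : W = tensorDilation U U' := hW
  subst hW
  have hW₂ := tensorDilation_conjTranspose_mul_self hU hU'
  apply le_antisymm
  · refine csSup_le (capVals_nonempty T₂) ?_
    rintro x ⟨m, p, v, hp, hs, hv, rfl⟩
    set σ : Mat (d × d') := ∑ i, (p i : ℂ) • pureState (v i) with hσ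
    have hσs : IsState σ := isState_sum_smul hp hs fun i => (hv i).isState_pureState
    set ω := tensorDilation U U' * σ * (tensorDilation U U')ᴴ with hω
    have hωs : IsState ω := hσs.conj_isometry hW₂
    have hEf : Ef ω ≤ ∑ i, p i * entropy (T₂ (pureState (v i))) := by
      refine csInf_le (bddBelow_efVals ω) ⟨m, p, fun i => tensorDilation U U' *ᵥ v i, hp,
        fun i => (hv i).mulVec hW₂, ?_, ?_⟩
      · simp only [hω, hσ, pureState_mulVec, Matrix.mul_sum, Matrix.sum_mul, Matrix.mul_smul,
          Matrix.smul_mul]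
      · simp only [channel_pureState hT₂]
    have hsub := hωs.isState_ptrace₁.entropy_subadditive
    have h₁ := hσs.isState_ptrace₂.entropy_sub_Ef_le_holevoCap hU hT
    have h₂ := hσs.isState_ptrace₁.entropy_sub_Ef_le_holevoCap hU' hT'
    have hS := hsuper ω hωs
    rw [← ptrace₁_marg₁, ← ptrace₁_marg₂, marg₁_conj_tensorDilation hU',
      marg₂_conj_tensorDilation hU, ← hT, ← hT'] at hsub
    rw [marg₁_conj_tensorDilation hU', marg₂_conj_tensorDilation hU] at hS
    rw [← channel_sum_smul hT₂, ← hσ, hT₂]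
    linarith
  · have hle : ∀ x ∈ capVals T, ∀ y ∈ capVals T', x + y ≤ holevoCap T₂ := fun x hx y hy =>
      le_csSup (bddAbove_capVals hW₂ hT₂) (add_mem_capVals hU hU' hT hT' hT₂ hx hy)
    have h₁ : ∀ y ∈ capVals T', holevoCap T ≤ holevoCap T₂ - y := fun y hy =>
      csSup_le (capVals_nonempty T) fun x hx => le_sub_iff_add_le.2 (hle x hx y hy)
    have h₂ : holevoCap T' ≤ holevoCap T₂ - holevoCap T :=
      csSup_le (capVals_nonempty T') fun y hy => by linarith [h₁ y hy]
    linarith
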